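/- Let Ω be a σ-finite measure space and ψ : Ω → (0,∞) measurable with M_ψ := sup_{s>0} s·μ({x : ψ(x) > s}) < ∞. Let Φ : B₁(H) + B₂(H) → {measurable functions on Ω} be a sublinear map satisfying: μ{x : |Φ(T)(x)| > α, weighted by ψ²} ≤ (‖T‖_{B₂}/α)² for T ∈ B₂, and ψ²-weighted measure of {|Φ(T)| > α} ≤ 2 M_ψ ‖T‖_{B₁}/α for T ∈ B₁. Then for 1 < p < 2 there exists C > 0 such that (∫_Ω |Φ(T)(x)|^p ψ(x)² dμ)^{1/p} ≤ C M_ψ^{(2−p)/p} ‖T‖_{B_p(H)} for all T ∈ B_p(H). -/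

import Mathlib

open MeasureTheory
open scoped ENNReal

variable {H : Type*} [NormedAddCommGroup H] [InnerProductSpace ℂ H] [CompleteSpace H]

/-- The `n`-th approximation number (= `(n+1)`-st singular value for compact
operators on a Hilbert space). -/
noncomputable def appNumber (T : H →L[ℂ] H) (n : ℕ) : ℝ :=
  sInf {r : ℝ | ∃ F : H →L[ℂ] H,
    FiniteDimensional ℂ (LinearMap.range (F : H →ₗ[ℂ] H)) ∧
    Module.finrank ℂ (LinearMap.range (F : H →ₗ[ℂ] H)) ≤ n ∧ ‖T - F‖ = r}

/-- The Schatten `p`-norm `(∑ₙ Sₙ(T)^p)^(1/p)` (valued in `ℝ≥0∞`). -/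
noncomputable def schattenNorm (p : ℝ) (T : H →L[ℂ] H) : ℝ≥0∞ :=
  (∑' n : ℕ, ENNReal.ofReal (appNumber T n) ^ p) ^ (1 / p)


section PaleyAux

lemma appNumber_bddBelow (T : H →L[ℂ] H) (n : ℕ) : BddBelow {r : ℝ | ∃ F : H →L[ℂ] H,
    FiniteDimensional ℂ (LinearMap.range (F : H →ₗ[ℂ] H)) ∧
    Module.finrank ℂ (LinearMap.range (F : H →ₗ[ℂ] H)) ≤ n ∧ ‖T - F‖ = r} :=
  ⟨0, by rintro r ⟨F, -, -, rfl⟩; exact norm_nonneg _⟩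

lemma appNumber_nonempty (T : H →L[ℂ] H) (n : ℕ) : {r : ℝ | ∃ F : H →L[ℂ] H,
    FiniteDimensional ℂ (LinearMap.range (F : H →ₗ[ℂ] H)) ∧
    Module.finrank ℂ (LinearMap.range (F : H →ₗ[ℂ] H)) ≤ n ∧ ‖T - F‖ = r}.Nonempty := by
  refine ⟨‖T - 0‖, 0, ?_, ?_, rfl⟩
  · rw [ContinuousLinearMap.toLinearMap_zero, LinearMap.range_zero]; infer_instance
  · rw [ContinuousLinearMap.toLinearMap_zero, LinearMap.range_zero]; simp

lemma appNumber_nonneg (T : H →L[ℂ] H) (n : ℕ) : 0 ≤ appNumber T n :=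
  Real.sInf_nonneg (by rintro r ⟨F, -, -, rfl⟩; exact norm_nonneg _)

lemma appNumber_le (T F : H →L[ℂ] H) (n : ℕ)
    (h1 : FiniteDimensional ℂ (LinearMap.range (F : H →ₗ[ℂ] H)))
    (h2 : Module.finrank ℂ (LinearMap.range (F : H →ₗ[ℂ] H)) ≤ n) :
    appNumber T n ≤ ‖T - F‖ :=
  csInf_le (appNumber_bddBelow T n) ⟨F, h1, h2, rfl⟩

lemma appNumber_exists (T : H →L[ℂ] H) (n : ℕ) (c : ℝ) (hc : appNumber T n < c) :
    ∃ F : H →L[ℂ] H, FiniteDimensional ℂ (LinearMap.range (F : H →ₗ[ℂ] H)) ∧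
    Module.finrank ℂ (LinearMap.range (F : H →ₗ[ℂ] H)) ≤ n ∧ ‖T - F‖ < c := by
  obtain ⟨r, ⟨F, h1, h2, rfl⟩, h3⟩ := exists_lt_of_csInf_lt (appNumber_nonempty T n) hc
  exact ⟨F, h1, h2, h3⟩

lemma appNumber_antitone (T : H →L[ℂ] H) : Antitone (appNumber T) := by
  intro m n hmn
  refine csInf_le_csInf (appNumber_bddBelow T n) (appNumber_nonempty T m) ?_
  rintro r ⟨F, h1, h2, h3⟩
  exact ⟨F, h1, h2.trans hmn, h3⟩

lemma appNumber_add (T S : H →L[ℂ] H) (m n : ℕ) :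
    appNumber (T + S) (m + n) ≤ appNumber T m + appNumber S n := by
  refine le_of_forall_pos_lt_add fun ε hε => ?_
  obtain ⟨F, a1, a2, a3⟩ := appNumber_exists T m (appNumber T m + ε / 2) (by linarith)
  obtain ⟨G, b1, b2, b3⟩ := appNumber_exists S n (appNumber S n + ε / 2) (by linarith)
  have hle : LinearMap.range ((F + G : H →L[ℂ] H) : H →ₗ[ℂ] H) ≤
      LinearMap.range (F : H →ₗ[ℂ] H) ⊔ LinearMap.range (G : H →ₗ[ℂ] H) :=
    LinearMap.range_add_le _ _
  have := appNumber_le (T + S) (F + G) (m + n) (Submodule.finiteDimensional_of_le hle)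
    ((Submodule.finrank_mono hle).trans
      ((Submodule.finrank_add_le_finrank_add_finrank _ _).trans (add_le_add a2 b2)))
  have h : ‖T + S - (F + G)‖ ≤ ‖T - F‖ + ‖S - G‖ := by
    rw [add_sub_add_comm]; exact norm_add_le _ _
  linarith

lemma appNumber_le_norm (T : H →L[ℂ] H) (n : ℕ) : appNumber T n ≤ ‖T‖ := by
  have := appNumber_le T 0 n
    (by rw [ContinuousLinearMap.toLinearMap_zero, LinearMap.range_zero]; infer_instance)
    (by rw [ContinuousLinearMap.toLinearMap_zero, LinearMap.range_zero]; simp)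
  simpa using this

lemma appNumber_finrank (F : H →L[ℂ] H) (n : ℕ)
    (h1 : FiniteDimensional ℂ (LinearMap.range (F : H →ₗ[ℂ] H)))
    (h2 : Module.finrank ℂ (LinearMap.range (F : H →ₗ[ℂ] H)) ≤ n) : appNumber F n = 0 := by
  have := appNumber_le F F n h1 h2
  simp at this
  exact le_antisymm this (appNumber_nonneg _ _)

lemma finrank_compact (F : H →L[ℂ] H)
    (h1 : FiniteDimensional ℂ (LinearMap.range (F : H →ₗ[ℂ] H))) : IsCompactOperator F := by
  have : LocallyCompactSpace (LinearMap.range (F : H →ₗ[ℂ] H)) :=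
    have := FiniteDimensional.proper ℂ (LinearMap.range (F : H →ₗ[ℂ] H))
    inferInstance
  have h := isCompactOperator_of_locallyCompactSpace_rng
    ((LinearMap.range (F : H →ₗ[ℂ] H)).subtypeL)
  have h2 := h.comp_clm (F.codRestrict (LinearMap.range (F : H →ₗ[ℂ] H)) (fun x => ⟨x, rfl⟩))
  exact h2

lemma exists_decomp (T : H →L[ℂ] H) (hT : IsCompactOperator T) (lam : ℝ) (hlam : 0 < lam)
    (hex : ∃ n, appNumber T n ≤ lam) :
    ∃ F G : H →L[ℂ] H, F + G = T ∧ IsCompactOperator F ∧ IsCompactOperator G ∧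
      schattenNorm 1 F ≤ ∑' k, ENNReal.ofReal (if lam < appNumber T k then 3 * appNumber T k else 0)
      ∧ schattenNorm 2 G ^ (2:ℝ) ≤ ∑' k, ENNReal.ofReal
        (if lam < appNumber T k then 8 * lam ^ 2 else appNumber T k ^ 2) := by
  classical
  let n := Nat.find hex
  have hn : appNumber T n ≤ lam := Nat.find_spec hex
  have hlt : ∀ k, k < n → lam < appNumber T k := fun k hk => not_le.1 (Nat.find_min hex hk)
  have hge : ∀ k, n ≤ k → appNumber T k ≤ lam := fun k hk => (appNumber_antitone T hk).trans hn
  obtain ⟨F, h1, h2, h3⟩ := appNumber_exists T n (2 * lam) (by linarith)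
  have hF := finrank_compact F h1
  refine ⟨F, T - F, by abel, hF, hT.sub hF, ?_, ?_⟩
  · simp only [schattenNorm, div_one, ENNReal.rpow_one]
    refine ENNReal.tsum_le_tsum fun k => ENNReal.ofReal_le_ofReal ?_
    split_ifs with hk
    · have a := appNumber_add T (F - T) k 0
      have b := appNumber_le_norm (F - T) 0
      rw [norm_sub_rev] at b
      rw [add_sub_cancel, add_zero] at a
      linarith
    · refine (appNumber_finrank F k h1 (h2.trans ?_)).le
      by_contra hc
      exact hk (hlt k (not_le.1 hc))
  · simp only [schattenNorm]
    rw [← ENNReal.rpow_mul]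
    norm_num only [ENNReal.rpow_one]
    have e1 : ∀ k, appNumber (T - F) k ≤ 2 * lam := fun k => (appNumber_le_norm _ k).trans h3.le
    have e2 : ∀ k, appNumber (T - F) (k + n) ≤ appNumber T k := fun k => by
      have a := appNumber_add T (-F) k n
      have b : appNumber (-F) n = 0 := by
        refine appNumber_finrank (-F) n ?_ ?_
        · rw [ContinuousLinearMap.toLinearMap_neg, LinearMap.range_neg]; exact h1
        · rw [ContinuousLinearMap.toLinearMap_neg, LinearMap.range_neg]; exact h2
      rw [b, add_zero, ← sub_eq_add_neg] at a
      exact a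
    rw [← Summable.sum_add_tsum_nat_add' (k := n + n) ENNReal.summable,
      ← Summable.sum_add_tsum_nat_add' (k := n)
        (f := fun k => ENNReal.ofReal
        (if lam < appNumber T k then 8 * lam ^ 2 else appNumber T k ^ 2)) ENNReal.summable]
    have pw : ∀ k, ENNReal.ofReal (appNumber (T - F) k) ^ (2:ℝ)
        = ENNReal.ofReal (appNumber (T - F) k ^ 2) := fun k => by
      rw [ENNReal.ofReal_rpow_of_nonneg (appNumber_nonneg _ _) (by norm_num), Real.rpow_two]
    simp only [pw]
    refine add_le_add ?_ (ENNReal.tsum_le_tsum fun k => ENNReal.ofReal_le_ofReal ?_)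
    · calc _ ≤ ∑ i ∈ Finset.range (n + n), ENNReal.ofReal (4 * lam ^ 2) := by
            refine Finset.sum_le_sum fun k _ => ENNReal.ofReal_le_ofReal ?_
            have := e1 k
            have := appNumber_nonneg (T - F) k
            nlinarith
        _ = ∑ i ∈ Finset.range n, ENNReal.ofReal (8 * lam ^ 2) := by
            rw [Finset.sum_const, Finset.sum_const, Finset.card_range, Finset.card_range,
              show 8 * lam ^ 2 = 4 * lam ^ 2 + 4 * lam ^ 2 by ring,
              ENNReal.ofReal_add (by positivity) (by positivity), smul_add, add_smul]
        _ ≤ _ := by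
            refine Finset.sum_le_sum fun k hk => ?_
            rw [if_pos (hlt k (Finset.mem_range.1 hk))]
    · rw [if_neg (not_lt.2 (hge _ (by omega)))]
      have a := e2 (k + n)
      rw [add_assoc] at a
      exact pow_le_pow_left₀ (appNumber_nonneg _ _) a 2

/-- the kernel of the interpolation argument -/
noncomputable def paleyKer (M s t : ℝ) : ℝ :=
  if M * t < s then 44 * M * s / t else 4 * s ^ 2 / t ^ 2

lemma paleyKer_measurable (M s : ℝ) : Measurable (paleyKer M s) := by
  unfold paleyKer
  refine Measurable.ite (measurableSet_lt (by fun_prop) (by fun_prop)) (by fun_prop) (by fun_prop)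

lemma paleyKer_integral (M s p : ℝ) (hM : 0 < M) (hs : 0 ≤ s) (hp : 1 < p) (hp2 : p < 2) :
    ∫⁻ t in Set.Ioi 0, ENNReal.ofReal (paleyKer M s t) * ENNReal.ofReal (t ^ (p - 1)) ≤
      ENNReal.ofReal ((44 / (p - 1) + 4 / (2 - p)) * M ^ (2 - p) * s ^ p) := by
  rcases hs.eq_or_lt with rfl | hs
  · rw [setLIntegral_congr_fun (g := fun _ => 0) measurableSet_Ioi]
    · simp
    · intro t ht
      have : ¬ (M * t < 0) := not_lt.2 (mul_nonneg hM.le (le_of_lt ht))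
      simp [paleyKer, this]
  have hc : 0 < s / M := by positivity
  set c := s / M with hcdef
  have hsc : s = M * c := by rw [hcdef]; field_simp
  rw [← Set.Ioc_union_Ioi_eq_Ioi hc.le,
    lintegral_union measurableSet_Ioi (Set.Ioc_disjoint_Ioi le_rfl)]
  have p1 : 0 < p - 1 := by linarith
  have p2 : 0 < 2 - p := by linarith
  have I1 : IntegrableOn (fun t : ℝ => 44 * M * s * t ^ (p - 2)) (Set.Ioc 0 c) := by
    have := (intervalIntegral.intervalIntegrable_rpow' (a := 0) (b := c) (r := p - 2)
      (by linarith)).1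
    exact this.const_mul _
  have I2 : IntegrableOn (fun t : ℝ => 4 * s ^ 2 * t ^ (p - 3)) (Set.Ioi c) :=
    (integrableOn_Ioi_rpow_of_lt (by linarith) hc).const_mul _
  have A1 : ∫⁻ t in Set.Ioc 0 c, ENNReal.ofReal (paleyKer M s t) * ENNReal.ofReal (t ^ (p - 1))
      ≤ ENNReal.ofReal (44 / (p - 1) * M ^ (2 - p) * s ^ p) := by
    calc _ ≤ ∫⁻ t in Set.Ioc 0 c, ENNReal.ofReal (44 * M * s * t ^ (p - 2)) := by
          refine setLIntegral_mono' measurableSet_Ioc fun t ht => ?_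
          have t0 : 0 < t := ht.1
          rw [← ENNReal.ofReal_mul' (by positivity)]
          refine ENNReal.ofReal_le_ofReal ?_
          rw [show p - 1 = (p - 2) + 1 by ring, Real.rpow_add_one t0.ne']
          have hk : paleyKer M s t * t ≤ 44 * M * s := by
            unfold paleyKer
            split_ifs with h
            · rw [div_mul_cancel₀ _ t0.ne']
            · have : t = c := le_antisymm ht.2 (by
                rw [hsc] at h; exact le_of_mul_le_mul_left (not_lt.1 h) hM)
              subst this
              have : 4 * s ^ 2 / c ^ 2 * c = 4 * M * s := by
                rw [hsc]; field_simp
              rw [this]; nlinarith [mul_pos hM hs]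
          have : 0 ≤ t ^ (p - 2) := by positivity
          nlinarith
      _ = ENNReal.ofReal (∫ t in Set.Ioc 0 c, 44 * M * s * t ^ (p - 2)) := by
          rw [ofReal_integral_eq_lintegral_ofReal I1]
          refine (ae_restrict_iff' measurableSet_Ioc).2 (Filter.Eventually.of_forall fun t ht => ?_)
          have t0 : 0 < t := ht.1
          show 0 ≤ _
          positivity
      _ = _ := by
          congr 1
          rw [integral_const_mul, ← intervalIntegral.integral_of_le hc.le,
            integral_rpow (Or.inl (by linarith)), Real.zero_rpow (by linarith), hsc,
            show p - 2 + 1 = p - 1 by ring, Real.mul_rpow hM.le hc.le,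
            show (2:ℝ) - p = 1 + 1 + - p by ring, Real.rpow_add hM, Real.rpow_add hM,
            Real.rpow_neg hM.le, Real.rpow_sub hc, Real.rpow_one, Real.rpow_one]
          have : M ^ p ≠ 0 := by positivity
          field_simp
          try ring
  have A2 : ∫⁻ t in Set.Ioi c, ENNReal.ofReal (paleyKer M s t) * ENNReal.ofReal (t ^ (p - 1))
      ≤ ENNReal.ofReal (4 / (2 - p) * M ^ (2 - p) * s ^ p) := by
    calc _ ≤ ∫⁻ t in Set.Ioi c, ENNReal.ofReal (4 * s ^ 2 * t ^ (p - 3)) := by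
          refine setLIntegral_mono' measurableSet_Ioi fun t ht => ?_
          have t0 : 0 < t := hc.trans ht
          rw [← ENNReal.ofReal_mul' (by positivity)]
          refine ENNReal.ofReal_le_ofReal ?_
          rw [show p - 1 = (p - 3) + 1 + 1 by ring, Real.rpow_add_one t0.ne',
            Real.rpow_add_one t0.ne']
          have h : ¬ (M * t < s) := by
            rw [hsc, not_lt]; exact mul_le_mul_of_nonneg_left (le_of_lt ht) hM.le
          simp only [paleyKer, if_neg h]
          apply le_of_eq
          field_simp
      _ = ENNReal.ofReal (∫ t in Set.Ioi c, 4 * s ^ 2 * t ^ (p - 3)) := by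
          rw [ofReal_integral_eq_lintegral_ofReal I2]
          refine (ae_restrict_iff' measurableSet_Ioi).2 (Filter.Eventually.of_forall fun t ht => ?_)
          have t0 : 0 < t := hc.trans ht
          show 0 ≤ _
          positivity
      _ = _ := by
          congr 1
          rw [integral_const_mul, integral_Ioi_rpow_of_lt (by linarith) hc, hsc,
            show p - 3 + 1 = p - 1 - 1 by ring, Real.mul_rpow hM.le hc.le,
            show M ^ (2 - p) = M ^ (1 + 1 + - p) by ring_nf, Real.rpow_add hM, Real.rpow_add hM,
            Real.rpow_neg hM.le, Real.rpow_sub hc, Real.rpow_sub hc, Real.rpow_one, Real.rpow_one]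
          have : M ^ p ≠ 0 := by positivity
          have e : p - 1 - 1 = - (2 - p) := by ring
          rw [e, div_neg, neg_div, neg_neg]
          field_simp
  refine (add_le_add A1 A2).trans ?_
  rw [← ENNReal.ofReal_add (by positivity) (by positivity)]
  apply le_of_eq
  congr 1
  ring

/-- layer-cake upper bound for a possibly non-measurable function -/
lemma lintegral_le_of_weak {Ω : Type*} [MeasurableSpace Ω] (μ : Measure Ω) [SigmaFinite μ]
    (w : Ω → ℝ≥0∞) (hw : Measurable w) (hw0 : ∀ x, w x ≠ 0) (hwt : ∀ x, w x ≠ ⊤)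
    (u : Ω → ℝ) (hu : ∀ x, 0 ≤ u x) (p : ℝ) (hp : 0 < p) (B : ℝ → ℝ≥0∞)
    (hB : ∀ t, 0 < t → μ.withDensity w {x | t < u x} ≤ B t) :
    ∫⁻ x, ENNReal.ofReal (u x) ^ p * w x ∂μ ≤
      ENNReal.ofReal p * ∫⁻ t in Set.Ioi 0, B t * ENNReal.ofReal (t ^ (p - 1)) := by
  obtain ⟨g, gm, gle, geq⟩ := exists_measurable_le_lintegral_eq μ
    (fun x => ENNReal.ofReal (u x) ^ p * w x)
  have hle : ∀ x, g x / w x ≤ ENNReal.ofReal (u x) ^ p := fun x =>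
    ENNReal.div_le_of_le_mul (gle x)
  have hfin : ∀ x, g x / w x ≠ ⊤ := fun x =>
    ((hle x).trans_lt (ENNReal.rpow_lt_top_of_nonneg hp.le ENNReal.ofReal_ne_top)).ne
  let f : Ω → ℝ := fun x => (g x / w x).toReal ^ (1 / p)
  have fm : Measurable f := (gm.div hw).ennreal_toReal.pow_const _
  have f0 : ∀ x, 0 ≤ f x := fun x => Real.rpow_nonneg ENNReal.toReal_nonneg _
  have fu : ∀ x, f x ≤ u x := fun x => by
    have h : (g x / w x).toReal ≤ u x ^ p := by
      have := ENNReal.toReal_mono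
        (ENNReal.rpow_lt_top_of_nonneg hp.le ENNReal.ofReal_ne_top).ne (hle x)
      rwa [ENNReal.ofReal_rpow_of_nonneg (hu x) hp.le,
        ENNReal.toReal_ofReal (Real.rpow_nonneg (hu x) _)] at this
    calc f x ≤ (u x ^ p) ^ (1 / p) :=
          Real.rpow_le_rpow ENNReal.toReal_nonneg h (by positivity)
      _ = u x := by
          rw [← Real.rpow_mul (hu x), mul_one_div_cancel hp.ne', Real.rpow_one]
  have fp : ∀ x, ENNReal.ofReal (f x ^ p) = g x / w x := fun x => by
    simp only [f]
    rw [← Real.rpow_mul ENNReal.toReal_nonneg, one_div_mul_cancel hp.ne', Real.rpow_one,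
      ENNReal.ofReal_toReal (hfin x)]
  have key := lintegral_rpow_eq_lintegral_meas_lt_mul (μ.withDensity w) (f := f)
    (Filter.Eventually.of_forall f0) fm.aemeasurable hp
  have e : ∫⁻ x, g x ∂μ = ∫⁻ x, ENNReal.ofReal (f x ^ p) ∂(μ.withDensity w) := by
    rw [lintegral_withDensity_eq_lintegral_mul μ hw (by fun_prop)]
    refine lintegral_congr fun x => ?_
    rw [Pi.mul_apply, fp, ENNReal.mul_div_cancel (hw0 x) (hwt x)]
  rw [geq, e, key]
  refine mul_le_mul_right ?_ _
  refine setLIntegral_mono' measurableSet_Ioi fun t ht => ?_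
  refine mul_le_mul_left ?_ _
  refine (measure_mono ?_).trans (hB t ht)
  intro x hx
  exact lt_of_lt_of_le hx (fu x)

end PaleyAux

/-- Paley inequality for a sublinear map `Φ` on Schatten classes
with values in measurable functions on a weighted measure space `dν = ψ² dμ`:
the weak-`(2,2)` and weak-`(1,1)` bounds imply, for `1 < p < 2`,
`(∫ |Φ(T)|^p ψ² dμ)^{1/p} ≤ C M_ψ^{(2−p)/p} ‖T‖_{B_p}`. -/
theorem paley_inverse_weyl [TopologicalSpace.SeparableSpace H]
    {Ω : Type*} [MeasurableSpace Ω] (μ : Measure Ω) [SigmaFinite μ]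
    (ψ : Ω → ℝ) (hψmeas : Measurable ψ) (hψpos : ∀ x, 0 < ψ x)
    (Mψ : ℝ) (hMψpos : 0 < Mψ)
    (hMψ : ∀ s : ℝ, 0 < s → ENNReal.ofReal s * μ {x | s < ψ x} ≤ ENNReal.ofReal Mψ)
    (Φ : (H →L[ℂ] H) → Ω → ℝ)
    (hsub : ∀ T S : H →L[ℂ] H, ∀ᵐ x ∂μ, |Φ (T + S) x| ≤ |Φ T x| + |Φ S x|)
    (hhom : ∀ (c : ℂ) (T : H →L[ℂ] H), ∀ᵐ x ∂μ, |Φ (c • T) x| = ‖c‖ * |Φ T x|)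
    (hB2 : ∀ T : H →L[ℂ] H, IsCompactOperator (⇑T) → schattenNorm 2 T < ⊤ →
      ∀ α : ℝ, 0 < α →
        (∫⁻ x in {x | α < |Φ T x|}, (ENNReal.ofReal (ψ x)) ^ (2 : ℝ) ∂μ)
          ≤ (schattenNorm 2 T / ENNReal.ofReal α) ^ (2 : ℝ))
    (hB1 : ∀ T : H →L[ℂ] H, IsCompactOperator (⇑T) → schattenNorm 1 T < ⊤ →
      ∀ α : ℝ, 0 < α →
        (∫⁻ x in {x | α < |Φ T x|}, (ENNReal.ofReal (ψ x)) ^ (2 : ℝ) ∂μ)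
          ≤ 2 * ENNReal.ofReal Mψ * schattenNorm 1 T / ENNReal.ofReal α) :
    ∀ p : ℝ, 1 < p → p < 2 →
      ∃ C : ℝ, 0 < C ∧ ∀ T : H →L[ℂ] H, IsCompactOperator (⇑T) →
        schattenNorm p T < ⊤ →
          (∫⁻ x, ENNReal.ofReal (|Φ T x|) ^ p * (ENNReal.ofReal (ψ x)) ^ (2 : ℝ) ∂μ)
              ^ (1 / p)
            ≤ ENNReal.ofReal (C * Mψ ^ ((2 - p) / p)) * schattenNorm p T := by
  intro p hp hp2
  have p0 : 0 < p := by linarith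
  set K : ℝ := p * (44 / (p - 1) + 4 / (2 - p)) with hK
  have hKpos : 0 < K := by
    have p1 : 0 < p - 1 := by linarith
    have p2 : 0 < 2 - p := by linarith
    positivity
  refine ⟨K ^ (1 / p), by positivity, fun T hT hTp => ?_⟩
  set w : Ω → ℝ≥0∞ := fun x => ENNReal.ofReal (ψ x) ^ (2 : ℝ) with hw
  have wm : Measurable w := by fun_prop
  have w0 : ∀ x, w x ≠ 0 := fun x => by
    simp [hw, hψpos x]
  have wt : ∀ x, w x ≠ ⊤ := fun x => by
    simp [hw]
  have hsum : ∑' n, ENNReal.ofReal (appNumber T n) ^ p ≠ ⊤ := by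
    intro h
    rw [schattenNorm, h, ENNReal.top_rpow_of_pos (by positivity)] at hTp
    exact lt_irrefl _ hTp
  have hex : ∀ lam : ℝ, 0 < lam → ∃ n, appNumber T n ≤ lam := fun lam hl => by
    have ht := ENNReal.tendsto_atTop_zero_of_tsum_ne_top hsum
    have hpos : (0:ℝ≥0∞) < ENNReal.ofReal lam ^ p :=
      ENNReal.rpow_pos (ENNReal.ofReal_pos.2 hl) ENNReal.ofReal_ne_top
    obtain ⟨n, hn⟩ := (ht.eventually (gt_mem_nhds hpos)).exists
    refine ⟨n, ?_⟩
    rw [ENNReal.rpow_lt_rpow_iff p0] at hn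
    exact ((ENNReal.ofReal_lt_ofReal_iff hl).1 hn).le
  have weak : ∀ t, 0 < t → μ.withDensity w {x | t < |Φ T x|} ≤
      ∑' k, ENNReal.ofReal (paleyKer Mψ (appNumber T k) t) := by
    intro t ht
    obtain ⟨F, G, hFG, hF, hG, nF, nG⟩ := exists_decomp T hT (Mψ * t) (by positivity)
      (hex _ (by positivity))
    have ht2 : 0 < t / 2 := by positivity
    set A := ∑' k, ENNReal.ofReal
      (if Mψ * t < appNumber T k then 3 * appNumber T k else 0) with hA
    set B := ∑' k, ENNReal.ofReal
      (if Mψ * t < appNumber T k then 8 * (Mψ * t) ^ 2 else appNumber T k ^ 2) with hBdef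
    have bF : μ.withDensity w {x | t / 2 < |Φ F x|} ≤ ENNReal.ofReal (4 * Mψ / t) * A := by
      by_cases h : A = ⊤
      · rw [h, ENNReal.mul_top (by rw [Ne, ENNReal.ofReal_eq_zero, not_le]; positivity)]
        exact le_top
      · rw [withDensity_apply']
        refine (hB1 F hF (nF.trans_lt (lt_top_iff_ne_top.2 h)) _ ht2).trans ?_
        rw [show 4 * Mψ / t = 2 * Mψ / (t / 2) by field_simp; ring,
          ENNReal.ofReal_div_of_pos ht2, ENNReal.ofReal_mul (by norm_num), ENNReal.ofReal_ofNat,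
          ENNReal.mul_div_right_comm]
        gcongr
    have bG : μ.withDensity w {x | t / 2 < |Φ G x|} ≤ ENNReal.ofReal (4 / t ^ 2) * B := by
      by_cases h : B = ⊤
      · rw [h, ENNReal.mul_top (by rw [Ne, ENNReal.ofReal_eq_zero, not_le]; positivity)]
        exact le_top
      · rw [withDensity_apply']
        have hfin : schattenNorm 2 G < ⊤ := by
          rw [lt_top_iff_ne_top]
          intro h2
          rw [h2, ENNReal.top_rpow_of_pos (by norm_num)] at nG
          exact h (top_le_iff.1 nG)
        refine (hB2 G hG hfin _ ht2).trans ?_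
        rw [ENNReal.div_rpow_of_nonneg _ _ (by norm_num),
          ENNReal.ofReal_rpow_of_nonneg ht2.le (by norm_num), Real.rpow_two,
          show 4 / t ^ 2 = ((t / 2) ^ 2)⁻¹ by field_simp; norm_num,
          ENNReal.ofReal_inv_of_pos (by positivity), div_eq_mul_inv, mul_comm]
        gcongr
    have hae : ∀ᵐ x ∂(μ.withDensity w), |Φ T x| ≤ |Φ F x| + |Φ G x| := by
      have := hsub F G
      rw [hFG] at this
      exact (withDensity_absolutelyContinuous μ w).ae_le this
    calc μ.withDensity w {x | t < |Φ T x|}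
        ≤ μ.withDensity w ({x | t / 2 < |Φ F x|} ∪ {x | t / 2 < |Φ G x|}) := by
          refine measure_mono_ae ?_
          filter_upwards [hae] with x hx hx2
          have hx2 : t < |Φ T x| := hx2
          by_contra hc
          have hc : ¬ (t / 2 < |Φ F x| ∨ t / 2 < |Φ G x|) := hc
          push Not at hc
          linarith [hc.1, hc.2]
      _ ≤ ENNReal.ofReal (4 * Mψ / t) * A + ENNReal.ofReal (4 / t ^ 2) * B :=
          (measure_union_le _ _).trans (add_le_add bF bG)
      _ ≤ _ := by
          rw [hA, hBdef, ← ENNReal.tsum_mul_left, ← ENNReal.tsum_mul_left, ← ENNReal.tsum_add]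
          refine ENNReal.tsum_le_tsum fun k => ?_
          have hk := appNumber_nonneg T k
          rw [← ENNReal.ofReal_mul (by positivity), ← ENNReal.ofReal_mul (by positivity),
            ← ENNReal.ofReal_add (by split_ifs <;> positivity) (by split_ifs <;> positivity)]
          refine ENNReal.ofReal_le_ofReal ?_
          unfold paleyKer
          split_ifs with h
          · have e1 : 4 * Mψ / t * (3 * appNumber T k) + 4 / t ^ 2 * (8 * (Mψ * t) ^ 2)
                = (12 * Mψ * appNumber T k + 32 * Mψ * (Mψ * t)) / t := by
              field_simp; ring
            rw [e1]
            refine div_le_div_of_nonneg_right ?_ ht.le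
            nlinarith
          · apply le_of_eq; ring
  have main := lintegral_le_of_weak μ w wm w0 wt (fun x => |Φ T x|) (fun x => abs_nonneg _) p p0 _
    weak
  have main2 : ∫⁻ x, ENNReal.ofReal (|Φ T x|) ^ p * w x ∂μ ≤
      ENNReal.ofReal (K * Mψ ^ (2 - p)) * ∑' n, ENNReal.ofReal (appNumber T n) ^ p := by
    refine main.trans ?_
    simp_rw [← ENNReal.tsum_mul_right]
    rw [lintegral_tsum (fun k => by
      have := paleyKer_measurable Mψ (appNumber T k)
      fun_prop), ← ENNReal.tsum_mul_left, ← ENNReal.tsum_mul_left]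
    refine ENNReal.tsum_le_tsum fun k => ?_
    have hk := appNumber_nonneg T k
    refine (mul_le_mul_right (paleyKer_integral Mψ (appNumber T k) p hMψpos hk hp hp2) _).trans ?_
    rw [ENNReal.ofReal_rpow_of_nonneg hk p0.le, ← ENNReal.ofReal_mul p0.le,
      ← ENNReal.ofReal_mul (by positivity)]
    apply le_of_eq
    congr 1
    rw [hK]; ring
  calc _ ≤ (ENNReal.ofReal (K * Mψ ^ (2 - p)) * ∑' n, ENNReal.ofReal (appNumber T n) ^ p)
        ^ (1 / p) := ENNReal.rpow_le_rpow main2 (by positivity)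
    _ = _ := by
      rw [ENNReal.mul_rpow_of_nonneg _ _ (by positivity), schattenNorm,
        ENNReal.ofReal_rpow_of_nonneg (by positivity) (by positivity),
        Real.mul_rpow (by positivity) (by positivity), ← Real.rpow_mul hMψpos.le, mul_one_div]
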